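/- There exist an absolute constant C ≥ 1 and a natural number t such that the following holds. Let 2 ≤ k ≤ 5 and 2 ≤ m ≤ k, and let α : G^k → 𝔽₂ be a multilinear form which is symmetric in its first m variables. Suppose the multilinear form (d, a₃, …, a_k) ↦ α(d, d, a₃, …, a_k) has partition rank at most r. Then there exist a subspace U ≤ G of codimension at most exp^{(t)}(C·r) and a multilinear form α' : U^k → 𝔽₂, also symmetric in its first m variables, such that α'(d, d, a₃, …, a_k) = 0 for all d, a₃, …, a_k ∈ U and prank(α|_{U×⋯×U} + α') ≤ exp(exp(C·r^C)). -/

import Mathlib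

open Finset

/-- `β : (Fin k → V) → ZMod 2` is a multilinear form in the variables indexed by `S`:
it depends only on the coordinates in `S` and is additive (hence `𝔽₂`-linear) in each of
those coordinates. -/
def MultilinearOn {V : Type*} [AddCommGroup V] [Module (ZMod 2) V] (k : ℕ)
    (S : Finset (Fin k)) (β : (Fin k → V) → ZMod 2) : Prop :=
  (∀ x y : Fin k → V, (∀ i ∈ S, x i = y i) → β x = β y) ∧
  (∀ i ∈ S, ∀ (x : Fin k → V) (u v : V),
    β (Function.update x i (u + v)) = β (Function.update x i u) + β (Function.update x i v))

/-- A multilinear form in all `k` variables. -/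
def IsMultilinear {V : Type*} [AddCommGroup V] [Module (ZMod 2) V] (k : ℕ)
    (α : (Fin k → V) → ZMod 2) : Prop :=
  MultilinearOn k Finset.univ α

/-- `α`, a multilinear form in the variables indexed by `S`, admits a partition-rank
decomposition with `m` terms. -/
def PrankDecompOn {V : Type*} [AddCommGroup V] [Module (ZMod 2) V] (k : ℕ)
    (S : Finset (Fin k)) (m : ℕ) (α : (Fin k → V) → ZMod 2) : Prop :=
  ∃ (I : Fin m → Finset (Fin k)) (β γ : Fin m → ((Fin k → V) → ZMod 2)),
    (∀ i, I i ⊆ S) ∧ (∀ i, I i ≠ ∅) ∧ (∀ i, I i ≠ S) ∧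
    (∀ i, MultilinearOn k (I i) (β i)) ∧
    (∀ i, MultilinearOn k (S \ I i) (γ i)) ∧
    (∀ x, α x = ∑ i, β i x * γ i x)

/-- The partition rank of a multilinear form in the variables indexed by `S`. -/
noncomputable def prankOn {V : Type*} [AddCommGroup V] [Module (ZMod 2) V] (k : ℕ)
    (S : Finset (Fin k)) (α : (Fin k → V) → ZMod 2) : ℕ :=
  sInf {m | PrankDecompOn k S m α}

/-- The partition rank of a multilinear form in `k` variables. -/
noncomputable def prank {V : Type*} [AddCommGroup V] [Module (ZMod 2) V] (k : ℕ)
    (α : (Fin k → V) → ZMod 2) : ℕ :=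
  prankOn k Finset.univ α

/-- `α ∘ π`: the form `(x₁, …, x_k) ↦ α(x_{π⁻¹(1)}, …, x_{π⁻¹(k)})`. -/
def permForm {V : Type*} (k : ℕ) (π : Equiv.Perm (Fin k))
    (α : (Fin k → V) → ZMod 2) : (Fin k → V) → ZMod 2 :=
  fun x => α (fun i => x (π.symm i))

/-- `α` is symmetric in its first `m` variables (0-indexed: coordinates `< m`). -/
def SymmetricInFirst {V : Type*} (k m : ℕ) (α : (Fin k → V) → ZMod 2) : Prop :=
  ∀ i j : Fin k, (i : ℕ) < m → (j : ℕ) < m → permForm k (Equiv.swap i j) α = α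

/-- `α` is symmetric in all of its variables. -/
def SymmetricForm {V : Type*} (k : ℕ) (α : (Fin k → V) → ZMod 2) : Prop :=
  ∀ π : Equiv.Perm (Fin k), permForm k π α = α

/-- `σ` is strongly symmetric: it is symmetric, and the form
`(x, y₃, …, y_k) ↦ σ(x, x, y₃, …, y_k)` is also symmetric.  (Given the symmetry of `σ`,
the latter is equivalent to being allowed to swap the doubled variable with the third
variable, which is how it is stated here.) -/
def StronglySymmetric {V : Type*} (k : ℕ) (σ : (Fin k → V) → ZMod 2) : Prop :=
  SymmetricForm k σ ∧
  ∀ (u v : V) (z : Fin k → V),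
    σ (fun i => if (i : ℕ) = 0 ∨ (i : ℕ) = 1 then u else if (i : ℕ) = 2 then v else z i) =
    σ (fun i => if (i : ℕ) = 0 ∨ (i : ℕ) = 1 then v else if (i : ℕ) = 2 then u else z i)

section Multilinear

variable {V : Type*} [AddCommGroup V] [Module (ZMod 2) V] {k : ℕ}

theorem MultilinearOn.exists_linear {j : Fin k} {β : (Fin k → V) → ZMod 2}
    (h : MultilinearOn k {j} β) : ∃ u : V →ₗ[ZMod 2] ZMod 2, ∀ x, β x = u (x j) := by
  refine ⟨(AddMonoidHom.mk' (fun v => β (Function.update 0 j v))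
    fun u v => h.2 j (by simp) 0 u v).toZModLinearMap 2, fun x => h.1 _ _ ?_⟩
  simp

theorem MultilinearOn.exists_bilinear {i j : Fin k} (hij : i ≠ j) {β : (Fin k → V) → ZMod 2}
    (h : MultilinearOn k {i, j} β) :
    ∃ b : V →ₗ[ZMod 2] V →ₗ[ZMod 2] ZMod 2, ∀ x, β x = b (x i) (x j) := by
  refine ⟨(AddMonoidHom.mk' (fun u => (AddMonoidHom.mk'
    (fun v => β (Function.update (Function.update 0 i u) j v))
    fun v w => h.2 j (by simp) _ v w).toZModLinearMap 2) fun u v => ?_).toZModLinearMap 2,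
    fun x => h.1 _ _ ?_⟩
  · ext w
    simp only [Function.update_comm hij]
    exact h.2 i (by simp) _ u v
  · simp [Function.update_of_ne hij]

theorem MultilinearOn.add {S : Finset (Fin k)} {β γ : (Fin k → V) → ZMod 2}
    (hβ : MultilinearOn k S β) (hγ : MultilinearOn k S γ) : MultilinearOn k S (β + γ) := by
  refine ⟨fun x y h => ?_, fun i hi x u v => ?_⟩
  · simp [hβ.1 x y h, hγ.1 x y h]
  · simp only [Pi.add_apply, hβ.2 i hi, hγ.2 i hi]
    ring

theorem MultilinearOn.mul_sdiff {S I : Finset (Fin k)} (hI : I ⊆ S)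
    {β γ : (Fin k → V) → ZMod 2} (hβ : MultilinearOn k I β) (hγ : MultilinearOn k (S \ I) γ) :
    MultilinearOn k S (fun x => β x * γ x) := by
  refine ⟨fun x y h => ?_, fun i hi x u v => ?_⟩
  · simp only
    rw [hβ.1 x y fun i hi => h i (hI hi), hγ.1 x y fun i hi => h i (Finset.mem_sdiff.1 hi).1]
  · by_cases hiI : i ∈ I
    · have key : ∀ w w', γ (Function.update x i w) = γ (Function.update x i w') := fun w w' =>
        hγ.1 _ _ fun l hl => by
          have : l ≠ i := fun e => (Finset.mem_sdiff.1 hl).2 (e ▸ hiI)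
          simp [this]
      simp only [hβ.2 i hiI, key (u + v) u, key v u]
      ring
    · have key : ∀ w w', β (Function.update x i w) = β (Function.update x i w') := fun w w' =>
        hβ.1 _ _ fun l hl => by
          have : l ≠ i := fun e => hiI (e ▸ hl)
          simp [this]
      simp only [hγ.2 i (Finset.mem_sdiff.2 ⟨hi, hiI⟩), key (u + v) u, key v u]
      ring

theorem MultilinearOn.sum {S : Finset (Fin k)} {ι : Type*} (s : Finset ι)
    {β : ι → (Fin k → V) → ZMod 2} (h : ∀ i ∈ s, MultilinearOn k S (β i)) :
    MultilinearOn k S (fun x => ∑ i ∈ s, β i x) := by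
  refine ⟨fun x y hxy => Finset.sum_congr rfl fun i hi => (h i hi).1 x y hxy,
    fun i hi x u v => ?_⟩
  rw [← Finset.sum_add_distrib]
  exact Finset.sum_congr rfl fun j hj => (h j hj).2 i hi x u v

theorem PrankDecompOn.multilinearOn {S : Finset (Fin k)} {m : ℕ} {f : (Fin k → V) → ZMod 2}
    (h : PrankDecompOn k S m f) : MultilinearOn k S f := by
  obtain ⟨I, β, γ, hI, -, -, hβ, hγ, hf⟩ := h
  rw [funext hf]
  exact MultilinearOn.sum _ fun i _ => (hβ i).mul_sdiff (hI i) (hγ i)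

theorem PrankDecompOn.add {S : Finset (Fin k)} {m m' : ℕ} {f g : (Fin k → V) → ZMod 2}
    (hf : PrankDecompOn k S m f) (hg : PrankDecompOn k S m' g) :
    PrankDecompOn k S (m + m') (fun x => f x + g x) := by
  obtain ⟨I, β, γ, h1, h2, h3, h4, h5, h6⟩ := hf
  obtain ⟨I', β', γ', h1', h2', h3', h4', h5', h6'⟩ := hg
  refine ⟨Fin.append I I', Fin.append β β', Fin.append γ γ', ?_, ?_, ?_, ?_, ?_, fun x => ?_⟩
  iterate 5
    intro i
    induction i using Fin.addCases <;> simp_all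
  simp [Fin.sum_univ_add, h6, h6']

theorem PrankDecompOn.sum {S : Finset (Fin k)} {m r : ℕ} {f : Fin r → (Fin k → V) → ZMod 2}
    (h : ∀ i, PrankDecompOn k S m (f i)) :
    PrankDecompOn k S (r * m) (fun x => ∑ i, f i x) := by
  induction r with
  | zero =>
    rw [Nat.zero_mul]
    exact ⟨Fin.elim0, Fin.elim0, Fin.elim0, fun i => i.elim0, fun i => i.elim0,
      fun i => i.elim0, fun i => i.elim0, fun i => i.elim0, fun x => by simp⟩
  | succ r ih =>
    simp only [Fin.sum_univ_castSucc, Nat.succ_mul]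
    exact (ih fun i => h i.castSucc).add (h _)

theorem PrankDecompOn.prank_le {m : ℕ} {f : (Fin k → V) → ZMod 2}
    (h : PrankDecompOn k Finset.univ m f) : prank k f ≤ m :=
  Nat.sInf_le h

theorem multilinearOn_trilinear {a b c : Fin k} (hab : a ≠ b) (hac : a ≠ c) (hbc : b ≠ c)
    {T : V → V → V → ZMod 2} (h₁ : ∀ u v y z, T (u + v) y z = T u y z + T v y z)
    (h₂ : ∀ x u v z, T x (u + v) z = T x u z + T x v z)
    (h₃ : ∀ x y u v, T x y (u + v) = T x y u + T x y v) :
    MultilinearOn k {a, b, c} (fun x => T (x a) (x b) (x c)) := by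
  refine ⟨fun x y h => ?_, fun i hi x u v => ?_⟩
  · simp [h a, h b, h c]
  · simp only [Finset.mem_insert, Finset.mem_singleton] at hi
    rcases hi with rfl | rfl | rfl <;>
      simp [hab, hac, hbc, hab.symm, hac.symm, hbc.symm, h₁, h₂, h₃]

theorem multilinearOn_bilinear {a b : Fin k} (hab : a ≠ b)
    {T : V → V → ZMod 2} (h₁ : ∀ u v y, T (u + v) y = T u y + T v y)
    (h₂ : ∀ x u v, T x (u + v) = T x u + T x v) :
    MultilinearOn k {a, b} (fun x => T (x a) (x b)) := by
  refine ⟨fun x y h => ?_, fun i hi x u v => ?_⟩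
  · simp [h a, h b]
  · simp only [Finset.mem_insert, Finset.mem_singleton] at hi
    rcases hi with rfl | rfl <;> simp [hab, hab.symm, h₁, h₂]

theorem prankDecompOn_trilinear_mul_bilinear {a b c d e : Fin 5} (h : [a, b, c, d, e].Nodup)
    {T : V → V → V → ZMod 2} (h₁ : ∀ u v y z, T (u + v) y z = T u y z + T v y z)
    (h₂ : ∀ x u v z, T x (u + v) z = T x u z + T x v z)
    (h₃ : ∀ x y u v, T x y (u + v) = T x y u + T x y v)
    {D : V → V → ZMod 2} (hD₁ : ∀ u v y, D (u + v) y = D u y + D v y)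
    (hD₂ : ∀ x u v, D x (u + v) = D x u + D x v) :
    PrankDecompOn 5 Finset.univ 1 (fun x : Fin 5 → V => T (x a) (x b) (x c) * D (x d) (x e)) := by
  simp only [List.nodup_cons, List.mem_cons, List.not_mem_nil, or_false, not_or,
    List.nodup_nil, and_true, not_false_eq_true] at h
  obtain ⟨⟨hab, hac, had, hae⟩, ⟨hbc, hbd, hbe⟩, ⟨hcd, hce⟩, hde⟩ := h
  have hS : (Finset.univ : Finset (Fin 5)) \ {a, b, c} = {d, e} := by
    symm
    apply Finset.eq_of_subset_of_card_le
    · intro i hi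
      simp only [Finset.mem_insert, Finset.mem_singleton] at hi
      rcases hi with rfl | rfl <;> simp [Ne.symm, *]
    · rw [Finset.card_sdiff_of_subset (Finset.subset_univ _), Finset.card_pair hde,
        Finset.card_eq_three.2 ⟨a, b, c, hab, hac, hbc, rfl⟩]
      simp
  refine ⟨fun _ => {a, b, c}, fun _ x => T (x a) (x b) (x c), fun _ x => D (x d) (x e),
    by simp, by simp, fun _ hu => ?_, fun _ => multilinearOn_trilinear hab hac hbc h₁ h₂ h₃,
    fun _ => ?_, by simp⟩
  · have hd : d ∈ ({a, b, c} : Finset (Fin 5)) := by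
      simp only at hu
      simp [hu]
    simp only [Finset.mem_insert, Finset.mem_singleton] at hd
    rcases hd with hd | hd | hd <;> exact absurd hd.symm (by assumption)
  · rw [hS]
    exact multilinearOn_bilinear hde hD₁ hD₂

end Multilinear

section Codimension

variable {V : Type*} [AddCommGroup V] [Module (ZMod 2) V]

theorem finrank_quotient_inf_ker_le {M : Type*} [AddCommGroup M] [Module (ZMod 2) M]
    [FiniteDimensional (ZMod 2) V] [FiniteDimensional (ZMod 2) M]
    (U : Submodule (ZMod 2) V) (L : V →ₗ[ZMod 2] M) :
    Module.finrank (ZMod 2) (V ⧸ (U ⊓ LinearMap.ker L)) ≤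
      Module.finrank (ZMod 2) (V ⧸ U) + Module.finrank (ZMod 2) M := by
  have h : U ⊓ LinearMap.ker L = LinearMap.ker (U.mkQ.prod L) := by
    rw [LinearMap.ker_prod, Submodule.ker_mkQ]
  rw [h, (LinearMap.quotKerEquivRange _).finrank_eq, ← Module.finrank_prod]
  exact Submodule.finrank_le _

theorem exists_regular_submodule {r : ℕ} (C : Fin r → V → V → ZMod 2) (N : ℕ)
    (U₀ : Submodule (ZMod 2) V) :
    ∃ U ≤ U₀, Module.finrank (ZMod 2) (V ⧸ U) ≤
        Module.finrank (ZMod 2) (V ⧸ U₀) + (N + 1) * r ∧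
      ∀ (a : Fin r → ZMod 2) (W : Submodule (ZMod 2) V), W ≤ U →
        Module.finrank (ZMod 2) (V ⧸ W) ≤ Module.finrank (ZMod 2) (V ⧸ U) + N →
        (∀ x ∈ W, ∀ y ∈ W, ∑ i, a i * C i x y = 0) →
        ∀ x ∈ U, ∀ y ∈ U, ∑ i, a i * C i x y = 0 := by
  let R : Submodule (ZMod 2) V → Submodule (ZMod 2) (Fin r → ZMod 2) := fun U =>
    { carrier := {a | ∀ x ∈ U, ∀ y ∈ U, ∑ i, a i * C i x y = 0}
      add_mem' := fun {a b} ha hb x hx y hy => by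
        simp [add_mul, Finset.sum_add_distrib, ha x hx y hy, hb x hx y hy]
      zero_mem' := fun x _ y _ => by simp
      smul_mem' := fun c a ha x hx y hy => by
        simp [mul_assoc, ← Finset.mul_sum, ha x hx y hy] }
  have hR : ∀ U, Module.finrank (ZMod 2) (R U) ≤ r := fun U => by
    simpa using Submodule.finrank_le (R U)
  let f : {U : Submodule (ZMod 2) V // U ≤ U₀} → ℕ := fun U =>
    Module.finrank (ZMod 2) (V ⧸ U.1) + (N + 1) * (r - Module.finrank (ZMod 2) (R U.1))
  have : Nonempty {U : Submodule (ZMod 2) V // U ≤ U₀} := ⟨⟨U₀, le_rfl⟩⟩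
  obtain ⟨⟨U, hU⟩, hmin⟩ : ∃ U, ∀ W, f U ≤ f W :=
    ⟨Function.argmin f, fun W => Function.argmin_le f W⟩
  refine ⟨U, hU, ?_, fun a W hW hc h => ?_⟩
  · have h1 := hmin ⟨U₀, le_rfl⟩
    have h2 : (N + 1) * (r - Module.finrank (ZMod 2) (R U₀)) ≤ (N + 1) * r :=
      Nat.mul_le_mul_left _ (Nat.sub_le _ _)
    simp only [f] at h1
    omega
  · by_contra hne
    have hlt : R U < R W := by
      refine lt_of_le_of_ne (fun b hb x hx y hy => hb x (hW hx) y (hW hy)) fun e => hne ?_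
      have : a ∈ R W := h
      rw [← e] at this
      exact this
    have h1 := Submodule.finrank_lt_finrank_of_lt hlt
    have h2 := hmin ⟨W, hW.trans hU⟩
    have h3 : (N + 1) * (r - Module.finrank (ZMod 2) (R W)) + (N + 1) ≤
        (N + 1) * (r - Module.finrank (ZMod 2) (R U)) := by
      rw [← Nat.mul_succ]
      have := hR W
      exact Nat.mul_le_mul_left _ (by omega)
    simp only [f] at h2
    omega

end Codimension

section Killing

variable {V : Type*} [AddCommGroup V] [Module (ZMod 2) V] [FiniteDimensional (ZMod 2) V]

theorem exists_submodule_forall_mul_eq_zero {K r : ℕ} {I : Fin r → Finset (Fin K)}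
    {β γ : Fin r → (Fin K → V) → ZMod 2} (hβ : ∀ i, MultilinearOn K (I i) (β i))
    (hγ : ∀ i, MultilinearOn K (Finset.univ \ I i) (γ i)) :
    ∃ U : Submodule (ZMod 2) V, Module.finrank (ZMod 2) (V ⧸ U) ≤ r ∧
      ∀ i, (∃ j, I i = {j} ∨ Finset.univ \ I i = {j}) →
        ∀ x : Fin K → V, (∀ l, x l ∈ U) → β i x * γ i x = 0 := by
  have key : ∀ i, ∃ u : V →ₗ[ZMod 2] ZMod 2, (∃ j, I i = {j} ∨ Finset.univ \ I i = {j}) →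
      ∀ x : Fin K → V, (∀ l, u (x l) = 0) → β i x * γ i x = 0 := by
    intro i
    by_cases h : ∃ j, I i = {j} ∨ Finset.univ \ I i = {j}
    · obtain ⟨j, hj | hj⟩ := h
      · obtain ⟨u, hu⟩ := (hj ▸ hβ i).exists_linear
        exact ⟨u, fun _ x hx => by rw [hu, hx, zero_mul]⟩
      · obtain ⟨u, hu⟩ := (hj ▸ hγ i).exists_linear
        exact ⟨u, fun _ x hx => by rw [hu, hx, mul_zero]⟩
    · exact ⟨0, fun h' => absurd h' h⟩
  choose u hu using key
  refine ⟨⊤ ⊓ LinearMap.ker (LinearMap.pi u), ?_, fun i hi x hx => hu i hi x fun l => ?_⟩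
  · refine (finrank_quotient_inf_ker_le _ _).trans ?_
    have : Module.finrank (ZMod 2) (V ⧸ (⊤ : Submodule (ZMod 2) V)) = 0 :=
      Module.finrank_zero_of_subsingleton
    simp [this]
  · exact congrFun (LinearMap.mem_ker.1 (hx l).2) i

theorem exists_submodule_forall_eq_zero_of_prankDecompOn {K r : ℕ} (hK : K ≤ 3)
    {φ : (Fin K → V) → ZMod 2} (h : PrankDecompOn K Finset.univ r φ) :
    ∃ U : Submodule (ZMod 2) V, Module.finrank (ZMod 2) (V ⧸ U) ≤ r ∧
      ∀ x : Fin K → V, (∀ l, x l ∈ U) → φ x = 0 := by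
  obtain ⟨I, β, γ, -, h₁, h₂, hβ, hγ, hφ⟩ := h
  obtain ⟨U, hU, hz⟩ := exists_submodule_forall_mul_eq_zero hβ hγ
  refine ⟨U, hU, fun x hx => ?_⟩
  rw [hφ]
  refine Finset.sum_eq_zero fun i _ => hz i ?_ x hx
  have : ∀ J : Finset (Fin K), J ≠ ∅ → J ≠ Finset.univ →
      ∃ j, J = {j} ∨ Finset.univ \ J = {j} := by
    interval_cases K <;> decide
  exact this _ (h₁ i) (h₂ i)

theorem exists_submodule_pairing_form {r : ℕ}
    {φ : (Fin 4 → V) → ZMod 2} (h : PrankDecompOn 4 Finset.univ r φ) :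
    ∃ (U : Submodule (ZMod 2) V) (A₀ A₁ A₂ C : Fin r → V →ₗ[ZMod 2] V →ₗ[ZMod 2] ZMod 2),
      Module.finrank (ZMod 2) (V ⧸ U) ≤ r ∧
      ∀ x ∈ U, ∀ y ∈ U, ∀ z ∈ U, ∀ w ∈ U, φ ![x, y, z, w] =
        ∑ i, (A₀ i x y * C i z w + A₁ i x z * C i y w + A₂ i x w * C i y z) := by
  obtain ⟨I, β, γ, -, h₁, h₂, hβ, hγ, hφ⟩ := h
  obtain ⟨U, hU, hz⟩ := exists_submodule_forall_mul_eq_zero hβ hγ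
  have key : ∀ i, ∃ a₀ a₁ a₂ c : V →ₗ[ZMod 2] V →ₗ[ZMod 2] ZMod 2,
      ∀ x : Fin 4 → V, (∀ l, x l ∈ U) → β i x * γ i x =
        a₀ (x 0) (x 1) * c (x 2) (x 3) + a₁ (x 0) (x 2) * c (x 1) (x 3) +
          a₂ (x 0) (x 3) * c (x 1) (x 2) := by
    intro i
    have hJ : ∀ J : Finset (Fin 4), J ≠ ∅ → J ≠ Finset.univ →
        (∃ j, J = {j} ∨ Finset.univ \ J = {j}) ∨
        (J = {0, 1} ∧ Finset.univ \ J = {2, 3}) ∨ (J = {0, 2} ∧ Finset.univ \ J = {1, 3}) ∨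
        (J = {0, 3} ∧ Finset.univ \ J = {1, 2}) ∨ (J = {2, 3} ∧ Finset.univ \ J = {0, 1}) ∨
        (J = {1, 3} ∧ Finset.univ \ J = {0, 2}) ∨ (J = {1, 2} ∧ Finset.univ \ J = {0, 3}) := by
      decide
    rcases hJ _ (h₁ i) (h₂ i) with h | ⟨h, h'⟩ | ⟨h, h'⟩ | ⟨h, h'⟩ | ⟨h, h'⟩ | ⟨h, h'⟩ | ⟨h, h'⟩
    · exact ⟨0, 0, 0, 0, fun x hx => by simp [hz i h x hx]⟩
    all_goals
      obtain ⟨b, hb⟩ := (h ▸ hβ i).exists_bilinear (by decide)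
      obtain ⟨c, hc⟩ := (h' ▸ hγ i).exists_bilinear (by decide)
    · exact ⟨b, 0, 0, c, fun x _ => by simp [hb, hc]⟩
    · exact ⟨0, b, 0, c, fun x _ => by simp [hb, hc]⟩
    · exact ⟨0, 0, b, c, fun x _ => by simp [hb, hc]⟩
    · exact ⟨c, 0, 0, b, fun x _ => by simp [hb, hc, mul_comm]⟩
    · exact ⟨0, c, 0, b, fun x _ => by simp [hb, hc, mul_comm]⟩
    · exact ⟨0, 0, c, b, fun x _ => by simp [hb, hc, mul_comm]⟩
  choose A₀ A₁ A₂ C hAC using key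
  refine ⟨U, A₀, A₁, A₂, C, hU, fun x hx y hy z hz' w hw => ?_⟩
  rw [hφ]
  refine Finset.sum_congr rfl fun i _ => hAC i _ fun l => ?_
  fin_cases l <;> simpa

/-- If a sum of products of bilinear forms over one pairing of four variables becomes a sum over
the other two pairings after a transposition, then it vanishes on a regular subspace. -/
theorem sum_mul_eq_zero_of_regular {r : ℕ} {U : Submodule (ZMod 2) V}
    (a e C f : Fin r → V →ₗ[ZMod 2] V →ₗ[ZMod 2] ZMod 2)
    (hreg : ∀ (t : Fin r → ZMod 2) (W : Submodule (ZMod 2) V), W ≤ U →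
        Module.finrank (ZMod 2) (V ⧸ W) ≤ Module.finrank (ZMod 2) (V ⧸ U) + 2 * r →
        (∀ x ∈ W, ∀ y ∈ W, ∑ i, t i * C i x y = 0) →
        ∀ x ∈ U, ∀ y ∈ U, ∑ i, t i * C i x y = 0)
    (h : ∀ d ∈ U, ∀ z ∈ U, ∀ w ∈ U, ∀ c ∈ U,
      ∑ i, a i d z * C i w c + ∑ i, a i d w * C i z c + ∑ i, e i d c * f i z w = 0) :
    ∀ d ∈ U, ∀ z ∈ U, ∀ w ∈ U, ∀ c ∈ U, ∑ i, a i d z * C i w c = 0 := by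
  intro d hd z hz
  refine hreg _ (U ⊓ LinearMap.ker
    ((LinearMap.pi fun i => a i d).prod (LinearMap.pi fun i => f i z))) inf_le_left ?_ ?_
  · refine (finrank_quotient_inf_ker_le _ _).trans ?_
    simp [two_mul]
  · rintro w ⟨hw, hw'⟩ c ⟨hc, -⟩
    have hw₁ : ∀ i, a i d w = 0 := congrFun (congrArg Prod.fst (LinearMap.mem_ker.1 hw'))
    have hw₂ : ∀ i, f i z w = 0 := congrFun (congrArg Prod.snd (LinearMap.mem_ker.1 hw'))
    simpa [hw₁, hw₂] using h d hd z hz w hw c hc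

/-- If `ψ d c z = ∑ i, A i d c * t i z` is linear in `z`, it vanishes for `z` in a subspace whose
codimension is at most the number of terms. -/
theorem exists_submodule_forall_eq_zero_of_sum {r : ℕ} {U : Submodule (ZMod 2) V}
    (A : Fin r → V → V → ZMod 2) (t : Fin r → V → ZMod 2) (ψ : V → V → V → ZMod 2)
    (hψ : ∀ d ∈ U, ∀ c ∈ U, ∀ z ∈ U, ψ d c z = ∑ i, A i d c * t i z)
    (hadd : ∀ d ∈ U, ∀ c ∈ U, ∀ z ∈ U, ∀ z' ∈ U, ψ d c (z + z') = ψ d c z + ψ d c z') :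
    ∃ K ≤ U, Module.finrank (ZMod 2) (V ⧸ K) ≤ Module.finrank (ZMod 2) (V ⧸ U) + r ∧
      ∀ d ∈ U, ∀ c ∈ U, ∀ z ∈ K, ψ d c z = 0 := by
  let Ψ : U →ₗ[ZMod 2] (U × U → ZMod 2) := (AddMonoidHom.mk'
    (fun (z : U) (p : U × U) => ψ p.1 p.2 z)
    fun z z' => funext fun p => hadd _ p.1.2 _ p.2.2 _ z.2 _ z'.2).toZModLinearMap 2
  let Θ : (Fin r → ZMod 2) →ₗ[ZMod 2] (U × U → ZMod 2) :=
    Fintype.linearCombination (ZMod 2) fun i (p : U × U) => A i p.1 p.2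
  have hle : LinearMap.range Ψ ≤ LinearMap.range Θ := by
    rintro _ ⟨z, rfl⟩
    refine ⟨fun i => t i z, funext fun p => ?_⟩
    simp only [Θ, Fintype.linearCombination_apply, Finset.sum_apply, Pi.smul_apply, smul_eq_mul]
    exact (Finset.sum_congr rfl fun i _ => mul_comm _ _).trans
      (hψ _ p.1.2 _ p.2.2 _ z.2).symm
  have hr : Module.finrank (ZMod 2) (LinearMap.range Ψ) ≤ r :=
    (Submodule.finrank_mono hle).trans ((LinearMap.finrank_range_le Θ).trans (by simp))
  refine ⟨(LinearMap.ker Ψ).map U.subtype, Submodule.map_subtype_le _ _, ?_, ?_⟩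
  · have h1 := LinearMap.finrank_range_add_finrank_ker Ψ
    have h2 := Submodule.finrank_quotient_add_finrank U
    have h3 := Submodule.finrank_quotient_add_finrank ((LinearMap.ker Ψ).map U.subtype)
    have h4 := Submodule.finrank_map_subtype_eq U (LinearMap.ker Ψ)
    omega
  · rintro d hd c hc _ ⟨z, hz, rfl⟩
    exact congrFun (LinearMap.mem_ker.1 hz) (⟨d, hd⟩, ⟨c, hc⟩)

end Killing

section Diagonal

theorem isMultilinear_diagonal {V : Type*} [AddCommGroup V] [Module (ZMod 2) V] {k m : ℕ}
    (hk : 2 ≤ k) (hm : 2 ≤ m) {α : (Fin k → V) → ZMod 2} (hα : IsMultilinear k α)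
    (hs : SymmetricInFirst k m α) (hlt : ∀ i : Fin k, (i : ℕ) - 1 < k - 1) :
    IsMultilinear (k - 1) (fun y : Fin (k - 1) → V => α fun i => y ⟨(i : ℕ) - 1, hlt i⟩) := by
  refine ⟨fun x y h => by rw [funext fun i => h i (Finset.mem_univ i)], fun j _ y u v => ?_⟩
  rcases Nat.eq_zero_or_pos j with hj | hj
  · let i₀ : Fin k := ⟨0, by omega⟩
    let i₁ : Fin k := ⟨1, by omega⟩
    have h01 : i₀ ≠ i₁ := by simp [i₀, i₁]
    let b : Fin k → V := fun i => y ⟨(i : ℕ) - 1, hlt i⟩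
    have hb : ∀ w, (fun i : Fin k => Function.update y j w ⟨(i : ℕ) - 1, hlt i⟩) =
        Function.update (Function.update b i₀ w) i₁ w := by
      intro w
      funext i
      simp only [Function.update_apply, Fin.ext_iff, b, i₀, i₁]
      split_ifs <;> first | rfl | omega
    have hsw : α (Function.update (Function.update b i₀ u) i₁ v) =
        α (Function.update (Function.update b i₀ v) i₁ u) := by
      rw [← congrFun (hs i₀ i₁ (by simp [i₀]; omega) (by simp [i₁]; omega))
        (Function.update (Function.update b i₀ v) i₁ u)]
      unfold permForm
      congr 1
      funext i
      simp only [Equiv.symm_swap, Equiv.swap_apply_def, Function.update_apply]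
      split_ifs <;> simp_all
    have h1 : ∀ c w w', α (Function.update c i₁ (w + w')) =
        α (Function.update c i₁ w) + α (Function.update c i₁ w') :=
      fun c w w' => hα.2 i₁ (Finset.mem_univ _) c w w'
    have h0 : ∀ c w w' t, α (Function.update (Function.update c i₀ (w + w')) i₁ t) =
        α (Function.update (Function.update c i₀ w) i₁ t) +
          α (Function.update (Function.update c i₀ w') i₁ t) := fun c w w' t => by
      simp only [Function.update_comm h01]
      exact hα.2 i₀ (Finset.mem_univ _) _ w w'
    simp only [hb, h1, h0, hsw]
    have := CharTwo.add_self_eq_zero (α (Function.update (Function.update b i₀ v) i₁ u))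
    linear_combination this
  · let i₁ : Fin k := ⟨j + 1, by omega⟩
    let b : Fin k → V := fun i => y ⟨(i : ℕ) - 1, hlt i⟩
    have hb : ∀ w, (fun i : Fin k => Function.update y j w ⟨(i : ℕ) - 1, hlt i⟩) =
        Function.update b i₁ w := by
      intro w
      funext i
      simp only [Function.update_apply, Fin.ext_iff, b, i₁]
      split_ifs <;> first | rfl | omega
    simp only [hb]
    exact hα.2 i₁ (Finset.mem_univ _) b u v

theorem exists_prankDecompOn {K n : ℕ} (hK : 2 ≤ K) {φ : (Fin K → Fin n → ZMod 2) → ZMod 2}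
    (hφ : IsMultilinear K φ) : PrankDecompOn K Finset.univ n φ := by
  let i₀ : Fin K := ⟨0, by omega⟩
  let i₁ : Fin K := ⟨1, by omega⟩
  have h01 : i₁ ≠ i₀ := by simp [i₀, i₁]
  refine ⟨fun _ => {i₀}, fun i x => x i₀ i,
    fun i x => φ (Function.update x i₀ (Pi.single i 1)), by simp, by simp, fun _ h => ?_,
    fun i => ⟨fun x y h => by simp [h i₀], fun l hl x u v => ?_⟩, fun i =>
    ⟨fun x y h => hφ.1 _ _ fun l _ => ?_, fun l hl x u v => ?_⟩, fun x => ?_⟩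
  · have := Finset.mem_univ i₁
    simp only at h
    rw [← h, Finset.mem_singleton] at this
    exact h01 this
  · rw [Finset.mem_singleton.1 hl]
    simp
  · by_cases hl : l = i₀
    · subst hl
      simp
    · simp [hl, h l]
  · have hl : l ≠ i₀ := by simpa using hl
    simp only [Function.update_comm hl]
    exact hφ.2 l (Finset.mem_univ _) _ u v
  · let L : (Fin n → ZMod 2) →ₗ[ZMod 2] ZMod 2 := (AddMonoidHom.mk'
      (fun v => φ (Function.update x i₀ v))
      fun u v => hφ.2 i₀ (Finset.mem_univ _) x u v).toZModLinearMap 2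
    have h : L (x i₀) = ∑ i, x i₀ i * L (Pi.single i 1) := by
      conv_lhs => rw [LinearMap.pi_apply_eq_sum_univ L (x i₀)]
      refine Finset.sum_congr rfl fun i _ => ?_
      rw [smul_eq_mul]
      congr 2
      ext j
      simp [Pi.single_apply, eq_comm]
    have h' : L (x i₀) = φ x := by simp [L]
    rw [← h', h]
    rfl

theorem prank_zero {V : Type*} [AddCommGroup V] [Module (ZMod 2) V] {k : ℕ}
    {f : (Fin k → V) → ZMod 2} (hf : f = 0) : prank k f = 0 := by
  refine Nat.le_zero.1 (PrankDecompOn.prank_le ⟨Fin.elim0, Fin.elim0, Fin.elim0,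
    fun i => i.elim0, fun i => i.elim0, fun i => i.elim0, fun i => i.elim0, fun i => i.elim0,
    fun x => by simp [hf]⟩)

end Diagonal

section Alternating

variable {V : Type*} [AddCommGroup V] [Module (ZMod 2) V]

/-- Correcting a form `α` by pairwise lifts `Λ` of its diagonal. -/
theorem exists_alternating_of_lift {m N : ℕ} (hm2 : 2 ≤ m) (hm5 : m ≤ 5)
    {α : (Fin 5 → V) → ZMod 2} (hα : IsMultilinear 5 α) (hs : SymmetricInFirst 5 m α)
    (Λ : V → V → V → V → V → ZMod 2) (hcomm : ∀ x y z w v, Λ x y z w v = Λ y x z w v)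
    (hdiag : ∀ x z w v, Λ x x z w v = α ![x, x, z, w, v])
    (h₂₃ : 4 ≤ m → ∀ x y z w v, Λ x y z w v = Λ x y w z v)
    (h₃₄ : 5 ≤ m → ∀ x y z w v, Λ x y z w v = Λ x y z v w)
    (hzero : 4 ≤ m → ∀ x y z v, Λ x y z z v = 0)
    (hdec : ∀ a b c d e : Fin 5, [a, b, c, d, e].Nodup →
      PrankDecompOn 5 Finset.univ N (fun x : Fin 5 → V => Λ (x a) (x b) (x c) (x d) (x e))) :
    ∃ α' : (Fin 5 → V) → ZMod 2, IsMultilinear 5 α' ∧ SymmetricInFirst 5 m α' ∧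
      (∀ (d : V) (a : Fin 5 → V), α' (fun i => if (i : ℕ) < 2 then d else a i) = 0) ∧
      prank 5 (α + α') ≤ 10 * N := by
  suffices h : ∃ (F : (Fin 5 → V) → ZMod 2) (M : ℕ), M ≤ 10 * N ∧
      PrankDecompOn 5 Finset.univ M F ∧ SymmetricInFirst 5 m F ∧
      (∀ d z w v : V, F ![d, d, z, w, v] = Λ d d z w v) by
    obtain ⟨F, M, hM, hF, hsF, hdF⟩ := h
    refine ⟨α + F, MultilinearOn.add hα hF.multilinearOn, fun i j hi hj => ?_,
      fun d a => ?_, ?_⟩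
    · have h1 := hs i j hi hj
      have h2 := hsF i j hi hj
      funext x
      exact congrArg₂ (· + ·) (congrFun h1 x) (congrFun h2 x)
    · have : (fun i : Fin 5 => if (i : ℕ) < 2 then d else a i) = ![d, d, a 2, a 3, a 4] := by
        funext i
        fin_cases i <;> rfl
      rw [this, Pi.add_apply, hdF, hdiag, CharTwo.add_self_eq_zero]
    · rw [← add_assoc, CharTwo.add_self_eq_zero, zero_add]
      exact hF.prank_le.trans hM
  have ht : ∀ t : ZMod 2, t + t = 0 := CharTwo.add_self_eq_zero
  obtain rfl | rfl | rfl | rfl : m = 2 ∨ m = 3 ∨ m = 4 ∨ m = 5 := by omega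
  · refine ⟨_, _, ?_, hdec 0 1 2 3 4 (by decide), ?_, fun d z w v => by simp⟩
    · omega
    · intro i j hi hj
      funext x
      fin_cases i <;> fin_cases j <;> simp at hi hj <;>
        simp [permForm, Equiv.swap_apply_def] <;> grind
  · refine ⟨_, _, ?_, ((hdec 0 1 2 3 4 (by decide)).add (hdec 0 2 1 3 4 (by decide))).add
      (hdec 1 2 0 3 4 (by decide)), ?_, fun d z w v => ?_⟩
    · omega
    · intro i j hi hj
      funext x
      fin_cases i <;> fin_cases j <;> simp at hi hj <;>
        simp [permForm, Equiv.swap_apply_def] <;> grind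
    · simp
      grind
  · have h := h₂₃ le_rfl
    have h0 := hzero le_rfl
    refine ⟨_, _, ?_, (((((hdec 0 1 2 3 4 (by decide)).add (hdec 0 2 1 3 4 (by decide))).add
      (hdec 1 2 0 3 4 (by decide))).add (hdec 0 3 1 2 4 (by decide))).add
      (hdec 1 3 0 2 4 (by decide))).add (hdec 2 3 0 1 4 (by decide)), ?_, fun d z w v => ?_⟩
    · omega
    · intro i j hi hj
      funext x
      fin_cases i <;> fin_cases j <;> simp at hi hj <;>
        simp [permForm, Equiv.swap_apply_def] <;> grind
    · simp
      grind
  · have h := h₂₃ (by omega)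
    have h' := h₃₄ le_rfl
    have h0 := hzero (by omega)
    refine ⟨_, _, ?_, (((((((((hdec 0 1 2 3 4 (by decide)).add (hdec 0 2 1 3 4 (by decide))).add
      (hdec 1 2 0 3 4 (by decide))).add (hdec 0 3 1 2 4 (by decide))).add
      (hdec 1 3 0 2 4 (by decide))).add (hdec 2 3 0 1 4 (by decide))).add
      (hdec 0 4 1 2 3 (by decide))).add (hdec 1 4 0 2 3 (by decide))).add
      (hdec 2 4 0 1 3 (by decide))).add (hdec 3 4 0 1 2 (by decide)), ?_, fun d z w v => ?_⟩
    · omega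
    · intro i j hi hj
      funext x
      fin_cases i <;> fin_cases j <;> simp at hi hj <;>
        simp [permForm, Equiv.swap_apply_def] <;> grind
    · simp
      grind

end Alternating

section FiveVariables

variable {V : Type*} [AddCommGroup V] [Module (ZMod 2) V] [FiniteDimensional (ZMod 2) V]

theorem exists_alternating_of_pairing_form {m r : ℕ} (hm2 : 2 ≤ m) (hm5 : m ≤ 5)
    {α : (Fin 5 → V) → ZMod 2} (hα : IsMultilinear 5 α) (hs : SymmetricInFirst 5 m α)
    (A₀ A₁ A₂ C : Fin r → V →ₗ[ZMod 2] V →ₗ[ZMod 2] ZMod 2)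
    (hφ : ∀ x y z w, α ![x, x, y, z, w] =
        ∑ i, (A₀ i x y * C i z w + A₁ i x z * C i y w + A₂ i x w * C i y z))
    (hzero : 4 ≤ m → ∀ x y z, α ![x, x, y, y, z] = 0) :
    ∃ α' : (Fin 5 → V) → ZMod 2, IsMultilinear 5 α' ∧ SymmetricInFirst 5 m α' ∧
      (∀ (d : V) (a : Fin 5 → V), α' (fun i => if (i : ℕ) < 2 then d else a i) = 0) ∧
      prank 5 (α + α') ≤ 30 * r := by
  let b := Module.finBasis (ZMod 2) V
  let S : (V →ₗ[ZMod 2] V →ₗ[ZMod 2] ZMod 2) → V → V → V → ZMod 2 := fun A x y z =>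
    ∑ j, b.repr x j * b.repr y j * A (b j) z
  have hS₁ : ∀ A u v y z, S A (u + v) y z = S A u y z + S A v y z := fun A u v y z => by
    simp [S, add_mul, Finset.sum_add_distrib]
  have hS₂ : ∀ A x u v z, S A x (u + v) z = S A x u z + S A x v z := fun A x u v z => by
    simp [S, mul_add, add_mul, Finset.sum_add_distrib]
  have hS₃ : ∀ A x y u v, S A x y (u + v) = S A x y u + S A x y v := fun A x y u v => by
    simp [S, mul_add, Finset.sum_add_distrib]
  let Λ : V → V → V → V → V → ZMod 2 := fun x y z w v =>
    ∑ j, b.repr x j * b.repr y j * α ![b j, b j, z, w, v]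
  have hΛS : ∀ x y z w v, Λ x y z w v =
      ∑ i, (S (A₀ i) x y z * C i w v + S (A₁ i) x y w * C i z v + S (A₂ i) x y v * C i z w) := by
    intro x y z w v
    simp only [Λ, S, hφ, Finset.mul_sum, Finset.sum_mul]
    rw [Finset.sum_comm]
    refine Finset.sum_congr rfl fun i _ => ?_
    rw [← Finset.sum_add_distrib, ← Finset.sum_add_distrib]
    exact Finset.sum_congr rfl fun j _ => by ring
  have hswap : ∀ i j : Fin 5, (i : ℕ) < m → (j : ℕ) < m → ∀ x : Fin 5 → V,
      α x = α (fun l => x (Equiv.swap i j l)) := fun i j hi hj x => by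
    simpa [permForm] using (congrFun (hs i j hi hj) x).symm
  have hdec : ∀ a b c d e : Fin 5, [a, b, c, d, e].Nodup →
      PrankDecompOn 5 Finset.univ (r * 3)
        (fun x : Fin 5 → V => Λ (x a) (x b) (x c) (x d) (x e)) := by
    intro p q c d e h
    simp only [hΛS]
    have h' : [p, q, d, c, e].Nodup := by
      refine (List.Perm.nodup_iff ?_).1 h
      exact ((List.Perm.swap d c [e]).cons q).cons p
    have h'' : [p, q, e, c, d].Nodup := by
      refine (List.Perm.nodup_iff ?_).1 h
      exact (((List.Perm.swap e d []).cons c).trans (List.Perm.swap e c [d])).cons q |>.cons p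
    refine PrankDecompOn.sum fun i => ?_
    have hT : ∀ (A : V →ₗ[ZMod 2] V →ₗ[ZMod 2] ZMod 2) {a b c d e : Fin 5},
        [a, b, c, d, e].Nodup → PrankDecompOn 5 Finset.univ 1
          (fun x : Fin 5 → V => S A (x a) (x b) (x c) * C i (x d) (x e)) := fun A _ _ _ _ _ h =>
      prankDecompOn_trilinear_mul_bilinear (T := S A) (D := fun x y => C i x y) h
        (hS₁ A) (hS₂ A) (hS₃ A) (fun u v y => by simp) (fun x u v => by simp)
    exact ((hT (A₀ i) h).add (hT (A₁ i) h')).add (hT (A₂ i) h'')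
  have hdiag : ∀ x z w v, Λ x x z w v = α ![x, x, z, w, v] := by
    intro x z w v
    have hsq : ∀ t : ZMod 2, t * t = t := by decide
    let L : V →ₗ[ZMod 2] ZMod 2 := ∑ i, (C i w v • (A₀ i).flip z +
      C i z v • (A₁ i).flip w + C i z w • (A₂ i).flip v)
    have hL : ∀ x, L x = α ![x, x, z, w, v] := fun x => by
      simp [L, hφ, mul_comm]
    simp only [Λ, hsq, ← hL]
    conv_rhs => rw [← b.sum_repr x]
    simp only [map_sum, map_smul, smul_eq_mul]
  have h₂₃ : 4 ≤ m → ∀ x y z w v, Λ x y z w v = Λ x y w z v := by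
    intro hm x y z w v
    refine Finset.sum_congr rfl fun j _ => ?_
    rw [hswap 2 3 (by simp; omega) (by simp; omega)]
    congr 2
    funext i
    fin_cases i <;> rfl
  have h₃₄ : 5 ≤ m → ∀ x y z w v, Λ x y z w v = Λ x y z v w := by
    intro hm x y z w v
    refine Finset.sum_congr rfl fun j _ => ?_
    rw [hswap 3 4 (by simp; omega) (by simp; omega)]
    congr 2
    funext i
    fin_cases i <;> rfl
  obtain ⟨α', h₁, h₂, h₃, h₄⟩ := exists_alternating_of_lift hm2 hm5 hα hs Λ
    (fun x y z w v => by simp only [Λ, mul_comm]) hdiag h₂₃ h₃₄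
    (fun hm x y z v => by simp [Λ, hzero hm]) hdec
  exact ⟨α', h₁, h₂, h₃, by omega⟩

theorem exists_submodule_pairing_form_diagonal {m r : ℕ}
    {α : (Fin 5 → V) → ZMod 2} (hs : SymmetricInFirst 5 m α) {φ : (Fin 4 → V) → ZMod 2}
    (hφα : ∀ x y z w, φ ![x, y, z, w] = α ![x, x, y, z, w]) (hφ : IsMultilinear 4 φ)
    (hdec : PrankDecompOn 4 Finset.univ r φ) :
    ∃ (U : Submodule (ZMod 2) V) (A₀ A₁ A₂ C : Fin r → V →ₗ[ZMod 2] V →ₗ[ZMod 2] ZMod 2),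
      Module.finrank (ZMod 2) (V ⧸ U) ≤ 2 * r ^ 2 + 3 * r ∧
      (∀ x ∈ U, ∀ y ∈ U, ∀ z ∈ U, ∀ w ∈ U, α ![x, x, y, z, w] =
        ∑ i, (A₀ i x y * C i z w + A₁ i x z * C i y w + A₂ i x w * C i y z)) ∧
      (4 ≤ m → ∀ x ∈ U, ∀ y ∈ U, ∀ z ∈ U, α ![x, x, y, y, z] = 0) := by
  obtain ⟨U₀, A₀, A₁, A₂, C, hU₀, h₀⟩ := exists_submodule_pairing_form hdec
  simp only [hφα] at h₀
  by_cases hm : 4 ≤ m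
  swap
  · exact ⟨U₀, A₀, A₁, A₂, C, hU₀.trans (by nlinarith), h₀, fun h => absurd h hm⟩
  obtain ⟨U, hUU₀, hU, hreg⟩ := exists_regular_submodule (fun i x y => C i x y) (2 * r) U₀
  have h₁ : ∀ x ∈ U, ∀ y ∈ U, ∀ z ∈ U, ∀ w ∈ U, α ![x, x, y, z, w] =
      ∑ i, (A₀ i x y * C i z w + A₁ i x z * C i y w + A₂ i x w * C i y z) :=
    fun x hx y hy z hz w hw => h₀ x (hUU₀ hx) y (hUU₀ hy) z (hUU₀ hz) w (hUU₀ hw)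
  have hsw : ∀ x y z w, α ![x, x, y, z, w] = α ![x, x, z, y, w] := fun x y z w => by
    rw [← congrFun (hs 2 3 (by simp; omega) (by simp; omega)) ![x, x, y, z, w]]
    unfold permForm
    congr 1
    funext i
    fin_cases i <;> rfl
  have hdiag : ∀ d ∈ U, ∀ c ∈ U, ∀ z ∈ U, α ![d, d, z, z, c] = ∑ i, A₂ i d c * C i z z := by
    have key := sum_mul_eq_zero_of_regular (fun i => A₀ i + A₁ i) A₂ C
      (fun i => C i + (C i).flip) hreg fun d hd z hz w hw c hc => ?_
    · intro d hd c hc z hz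
      rw [h₁ d hd z hz z hz c hc, ← zero_add (∑ i, A₂ i d c * C i z z),
        ← key d hd z hz z hz c hc, ← Finset.sum_add_distrib]
      simp [add_mul]
    · have h2 := congrArg₂ (· + ·) (h₁ d hd z hz w hw c hc) (h₁ d hd w hw z hz c hc)
      simp only [hsw d z w c, CharTwo.add_self_eq_zero, ← Finset.sum_add_distrib] at h2
      rw [h2, ← Finset.sum_add_distrib, ← Finset.sum_add_distrib]
      refine Finset.sum_congr rfl fun i _ => ?_
      simp
      ring
  obtain ⟨K, hKU, hK, hKz⟩ := exists_submodule_forall_eq_zero_of_sum (U := U)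
    (fun i d c => A₂ i d c) (fun i z => C i z z) (fun d c z => α ![d, d, z, z, c]) hdiag
    fun d _ c _ z _ z' _ => by
      have e1 : ∀ u v w, α ![d, d, u + v, w, c] = α ![d, d, u, w, c] + α ![d, d, v, w, c] := by
        intro u v w
        have := hφ.2 1 (Finset.mem_univ _) ![d, u, w, c] u v
        have e : ∀ t, Function.update ![d, u, w, c] 1 t = ![d, t, w, c] := fun t => by
          funext i
          fin_cases i <;> rfl
        simpa only [e, hφα] using this
      have e2 : ∀ u v w, α ![d, d, w, u + v, c] = α ![d, d, w, u, c] + α ![d, d, w, v, c] := by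
        intro u v w
        rw [hsw, e1, hsw d u, hsw d v]
      simp only [e1, e2]
      rw [hsw d z' z]
      linear_combination CharTwo.add_self_eq_zero (α ![d, d, z, z', c])
  refine ⟨K, A₀, A₁, A₂, C, ?_, fun x hx y hy z hz w hw =>
    h₁ x (hKU hx) y (hKU hy) z (hKU hz) w (hKU hw), fun _ x hx y hy z hz =>
    hKz x (hKU hx) z (hKU hz) y hy⟩
  nlinarith

end FiveVariables

theorem IsMultilinear.restrict {V : Type*} [AddCommGroup V] [Module (ZMod 2) V] {k : ℕ}
    {α : (Fin k → V) → ZMod 2} (hα : IsMultilinear k α) (U : Submodule (ZMod 2) V) :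
    IsMultilinear k (fun x : Fin k → U => α fun i => (x i : V)) := by
  refine ⟨fun x y h => by rw [funext fun i => h i (Finset.mem_univ i)], fun i hi x u v => ?_⟩
  have e : ∀ w : U, (fun l => (Function.update x i w l : V)) =
      Function.update (fun l => (x l : V)) i w := fun w => by
    funext l
    by_cases hl : l = i
    · subst hl
      simp
    · simp [hl]
  simp only [e]
  exact hα.2 i hi _ u v

theorem SymmetricInFirst.restrict {V : Type*} [AddCommGroup V] [Module (ZMod 2) V] {k m : ℕ}
    {α : (Fin k → V) → ZMod 2} (hα : SymmetricInFirst k m α) (U : Submodule (ZMod 2) V) :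
    SymmetricInFirst k m (fun x : Fin k → U => α fun i => (x i : V)) :=
  fun i j hi hj => funext fun x => congrFun (hα i j hi hj) fun i => (x i : V)

/-- Polynomial-strength version of the main theorem. -/
theorem exists_submodule_exists_alternating {k m n : ℕ} (hk2 : 2 ≤ k) (hk5 : k ≤ 5)
    (hm2 : 2 ≤ m) (hmk : m ≤ k) {α : (Fin k → (Fin n → ZMod 2)) → ZMod 2}
    (hα : IsMultilinear k α) (hs : SymmetricInFirst k m α)
    (hlt : ∀ i : Fin k, (i : ℕ) - 1 < k - 1) :
    let r := prank (k - 1) (fun y : Fin (k - 1) → Fin n → ZMod 2 =>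
      α fun i => y ⟨(i : ℕ) - 1, hlt i⟩)
    ∃ U : Submodule (ZMod 2) (Fin n → ZMod 2),
      Module.finrank (ZMod 2) ((Fin n → ZMod 2) ⧸ U) ≤ 2 * r ^ 2 + 3 * r + 1 ∧
      ∃ α' : (Fin k → U) → ZMod 2,
        IsMultilinear k α' ∧ SymmetricInFirst k m α' ∧
        (∀ (d : U) (a : Fin k → U), α' (fun i => if (i : ℕ) < 2 then d else a i) = 0) ∧
        prank k ((fun x : Fin k → U => α fun i => (x i : Fin n → ZMod 2)) + α') ≤ 30 * r := by
  have hφ := isMultilinear_diagonal hk2 hm2 hα hs hlt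
  set φ := fun y : Fin (k - 1) → Fin n → ZMod 2 => α fun i => y ⟨(i : ℕ) - 1, hlt i⟩ with hφd
  intro r
  have hdec : 3 ≤ k → PrankDecompOn (k - 1) Finset.univ r φ := fun hk =>
    Nat.sInf_mem (s := {m | PrankDecompOn (k - 1) Finset.univ m φ})
      ⟨n, exists_prankDecompOn (by omega) hφ⟩
  obtain rfl | hk4 : k = 5 ∨ k ≤ 4 := by omega
  · obtain ⟨U, A₀, A₁, A₂, C, hU, h₁, h₂⟩ := exists_submodule_pairing_form_diagonal (φ := φ) hs
      (fun x y z w => by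
        simp only [hφd]
        congr 1
        funext i
        fin_cases i <;> rfl) hφ (hdec (by omega))
    have ev : ∀ x y z w v : U, (fun i : Fin 5 => ((![x, y, z, w, v] i : U) : Fin n → ZMod 2)) =
        ![(x : Fin n → ZMod 2), y, z, w, v] := fun x y z w v => by
      funext i
      fin_cases i <;> rfl
    refine ⟨U, by omega, exists_alternating_of_pairing_form hm2 hmk (hα.restrict U)
      (hs.restrict U) (fun i => (A₀ i).domRestrict₁₂ U U) (fun i => (A₁ i).domRestrict₁₂ U U)
      (fun i => (A₂ i).domRestrict₁₂ U U) (fun i => (C i).domRestrict₁₂ U U)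
      (fun x y z w => ?_) fun hm x y z => ?_⟩
    · simp only [ev]
      exact h₁ _ x.2 _ y.2 _ z.2 _ w.2
    · simp only [ev]
      exact h₂ hm _ x.2 _ y.2 _ z.2
  · obtain ⟨U, hU, hz⟩ : ∃ U : Submodule (ZMod 2) (Fin n → ZMod 2),
        Module.finrank (ZMod 2) ((Fin n → ZMod 2) ⧸ U) ≤ r + 1 ∧
        ∀ x : Fin (k - 1) → Fin n → ZMod 2, (∀ l, x l ∈ U) → φ x = 0 := by
      obtain rfl | hk3 : k = 2 ∨ 3 ≤ k := by omega
      · have hone : MultilinearOn 1 {0} φ := hφ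
        obtain ⟨u, hu⟩ := hone.exists_linear
        refine ⟨⊤ ⊓ LinearMap.ker u, ?_, fun x hx => ?_⟩
        · refine (finrank_quotient_inf_ker_le _ _).trans ?_
          have : Module.finrank (ZMod 2)
              ((Fin n → ZMod 2) ⧸ (⊤ : Submodule (ZMod 2) (Fin n → ZMod 2))) = 0 :=
            Module.finrank_zero_of_subsingleton
          simp [this]
        · rw [hu]
          exact LinearMap.mem_ker.1 (hx 0).2
      · obtain ⟨U, hU, hz⟩ := exists_submodule_forall_eq_zero_of_prankDecompOn (by omega)
          (hdec hk3)
        exact ⟨U, by omega, hz⟩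
    refine ⟨U, hU.trans (by nlinarith), _, hα.restrict U, hs.restrict U, fun d a => ?_, ?_⟩
    · have h := hz (fun j => if (j : ℕ) = 0 then d else a ⟨j + 1, by omega⟩) fun l => by
        split_ifs <;> exact Subtype.property _
      rw [← h]
      simp only [hφd]
      congr 1
      funext i
      by_cases hi : (i : ℕ) < 2
      · simp [hi, show (i : ℕ) - 1 = 0 by omega]
      · simp only [hi, if_false, show (i : ℕ) - 1 ≠ 0 by omega]
        congr 2
        ext
        simp
        omega
    · rw [CharTwo.add_self_eq_zero, prank_zero rfl]
      exact Nat.zero_le _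

/-- **Theorem 8 (removing repeated coordinates).**
There are `C ≥ 1` and `t ∈ ℕ` such that for `2 ≤ k ≤ 5` and `2 ≤ m ≤ k`: if
`α : G^k → 𝔽₂` is multilinear, symmetric in its first `m` variables, and the
`(k-1)`-variable multilinear form `(d,a₃,…,a_k) ↦ α(d,d,a₃,…,a_k)` has partition rank at
most `r`, then there are a subspace `U ≤ G` of codimension at most `exp^{(t)}(C·r)` and
a multilinear form `α' : U^k → 𝔽₂`, symmetric in its first `m` variables, vanishing on
repeated first coordinates, with `prank(α|_U + α') ≤ exp(exp(C·r^C))`. -/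
theorem statement6 :
    ∃ (C : ℝ) (t : ℕ), 1 ≤ C ∧
      ∀ (k m : ℕ) (hk2 : 2 ≤ k) (hk5 : k ≤ 5) (hm2 : 2 ≤ m) (hmk : m ≤ k)
        (n : ℕ) (α : (Fin k → (Fin n → ZMod 2)) → ZMod 2),
        IsMultilinear k α → SymmetricInFirst k m α →
        ∀ r : ℕ,
          prank (k - 1) (fun y : Fin (k - 1) → Fin n → ZMod 2 =>
              α fun i => y ⟨(i : ℕ) - 1, by have := i.isLt; omega⟩) ≤ r →
          ∃ U : Submodule (ZMod 2) (Fin n → ZMod 2),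
            (Module.finrank (ZMod 2) ((Fin n → ZMod 2) ⧸ U) : ℝ) ≤
              Real.exp^[t] (C * r) ∧
            ∃ α' : (Fin k → U) → ZMod 2,
              IsMultilinear k α' ∧ SymmetricInFirst k m α' ∧
              (∀ (d : U) (a : Fin k → U),
                α' (fun i => if (i : ℕ) < 2 then d else a i) = 0) ∧
              (prank k ((fun x : Fin k → U =>
                  α fun i => (x i : Fin n → ZMod 2)) + α') : ℝ) ≤
                Real.exp (Real.exp (C * (r : ℝ) ^ C)) := by
  refine ⟨100, 1, by norm_num, fun k m hk2 hk5 hm2 hmk n α hα hs r hr => ?_⟩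
  obtain ⟨U, hU, α', h₁, h₂, h₃, h₄⟩ :=
    exists_submodule_exists_alternating hk2 hk5 hm2 hmk hα hs fun i => by omega
  set s := prank (k - 1) (fun y : Fin (k - 1) → Fin n → ZMod 2 =>
    α fun i => y ⟨(i : ℕ) - 1, by omega⟩)
  have hsr : (s : ℝ) ≤ r := by exact_mod_cast hr
  have hs0 : (0 : ℝ) ≤ s := Nat.cast_nonneg s
  refine ⟨U, ?_, α', h₁, h₂, h₃, ?_⟩
  · have hU' : (Module.finrank (ZMod 2) ((Fin n → ZMod 2) ⧸ U) : ℝ) ≤ 2 * s ^ 2 + 3 * s + 1 := by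
      exact_mod_cast hU
    rw [Function.iterate_one]
    have h := Real.quadratic_le_exp_of_nonneg (x := 100 * r) (by positivity)
    refine hU'.trans (le_trans ?_ h)
    nlinarith
  · have h₄' : (prank k ((fun x : Fin k → U => α fun i => (x i : Fin n → ZMod 2)) + α') : ℝ) ≤
        30 * s := by
      exact_mod_cast h₄
    refine h₄'.trans ?_
    rcases Nat.eq_zero_or_pos r with rfl | hpos
    · have : (s : ℝ) = 0 := le_antisymm (by simpa using hsr) hs0
      rw [this, mul_zero]
      positivity
    · have hr1 : (1 : ℝ) ≤ r := by exact_mod_cast hpos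
      have hpow : (r : ℝ) ≤ (r : ℝ) ^ (100 : ℝ) := by
        simpa using Real.rpow_le_rpow_of_exponent_le hr1 (show (1 : ℝ) ≤ 100 by norm_num)
      have e1 := Real.add_one_le_exp (100 * (r : ℝ) ^ (100 : ℝ))
      have e2 := Real.add_one_le_exp (Real.exp (100 * (r : ℝ) ^ (100 : ℝ)))
      linarith
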